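/- There exist a set S ⊆ ℤ and a constant K > 0 such that S satisfies the Λ(4) inequality with constant K, and for all positive integers k and g, S cannot be written as the union of k sets each of which is either a B₂[g] set or a B₂°[g] set. -/

import Mathlib

/-- `S ⊆ G` is a `B₂[g]` set: every element has at most `g` representations as a sum
`a + b` with `a, b ∈ S`, counting representations differing only in order as one. -/
def IsB2 {G : Type} [AddCommGroup G] (g : ℕ) (S : Set G) : Prop :=
  ∀ ξ : G, {p : Sym2 G | ∃ a ∈ S, ∃ b ∈ S, p = s(a, b) ∧ a + b = ξ}.encard ≤ g

/-- `S ⊆ G` is a `B₂°[g]` set: every nonzero element has at most `g` representations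
as a difference `a - b` with `a, b ∈ S`. -/
def IsB2Circ {G : Type} [AddCommGroup G] (g : ℕ) (S : Set G) : Prop :=
  ∀ ξ : G, ξ ≠ 0 → {p : G × G | p.1 ∈ S ∧ p.2 ∈ S ∧ p.1 - p.2 = ξ}.encard ≤ g

/-- `S ⊆ ℤ` satisfies the `Λ(4)` inequality with constant `K`. -/
def SatisfiesLambda4 (S : Set ℤ) (K : ℝ) : Prop :=
  ∀ f : ℤ →₀ ℂ, (↑f.support : Set ℤ) ⊆ S →
    MeasureTheory.eLpNorm
      (fun x : AddCircle (1 : ℝ) => ∑ ξ ∈ f.support, f ξ * fourier ξ x) 4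
      AddCircle.haarAddCircle
      ≤ ENNReal.ofReal (K * Real.sqrt (∑ ξ ∈ f.support, ‖f ξ‖ ^ 2))

lemma digits_inj : ∀ (N : ℕ) (u v : ℕ → ℕ), (∀ i, u i ≤ 4) → (∀ i, v i ≤ 4) →
    ∑ i ∈ Finset.range N, u i * 5 ^ i = ∑ i ∈ Finset.range N, v i * 5 ^ i →
    ∀ i < N, u i = v i := by
  intro N
  induction N with
  | zero => intro u v _ _ _ i hi; omega
  | succ N ih =>
    intro u v hu hv h
    rw [Finset.sum_range_succ', Finset.sum_range_succ'] at h
    have e : ∀ w : ℕ → ℕ, ∑ i ∈ Finset.range N, w (i+1) * 5 ^ (i+1)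
        = 5 * ∑ i ∈ Finset.range N, w (i+1) * 5 ^ i := by
      intro w
      rw [Finset.mul_sum]
      refine Finset.sum_congr rfl fun i _ => ?_
      ring
    rw [e, e] at h
    have h0 := hu 0
    have h1 := hv 0
    simp only [pow_zero, mul_one] at h
    have hs : ∑ i ∈ Finset.range N, u (i+1) * 5 ^ i = ∑ i ∈ Finset.range N, v (i+1) * 5 ^ i := by
      omega
    have := ih (fun i => u (i+1)) (fun i => v (i+1)) (fun i => hu _) (fun i => hv _) hs
    intro i hi
    cases i with
    | zero => omega
    | succ i => exact this i (by omega)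

lemma four_pow {a b c d a' b' c' d' : ℕ}
    (h : 5 ^ a + 5 ^ b + 5 ^ c + 5 ^ d = 5 ^ a' + 5 ^ b' + 5 ^ c' + 5 ^ d') (t : ℕ) :
    (if a = t then 1 else 0) + (if b = t then 1 else 0) + (if c = t then 1 else 0)
      + (if d = t then 1 else 0) =
    (if a' = t then 1 else 0) + (if b' = t then 1 else 0) + (if c' = t then 1 else 0)
      + (if d' = t then 1 else 0) := by
  set N := a + b + c + d + a' + b' + c' + d' + t + 1 with hN
  have key : ∀ a b c d : ℕ, a < N → b < N → c < N → d < N →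
      ∑ i ∈ Finset.range N, ((if a = i then 1 else 0) + (if b = i then 1 else 0)
        + (if c = i then 1 else 0) + (if d = i then 1 else 0)) * 5 ^ i
        = 5 ^ a + 5 ^ b + 5 ^ c + 5 ^ d := by
    intro a b c d ha hb hc hd
    simp [add_mul, Finset.sum_add_distrib, ha, hb, hc, hd]
  refine digits_inj N (fun t => (if a = t then 1 else 0) + (if b = t then 1 else 0)
    + (if c = t then 1 else 0) + (if d = t then 1 else 0)) (fun t => (if a' = t then 1 else 0)
    + (if b' = t then 1 else 0) + (if c' = t then 1 else 0) + (if d' = t then 1 else 0))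
    ?_ ?_ ?_ t (by omega)
  · intro i; split_ifs <;> simp
  · intro i; split_ifs <;> simp
  · rw [key _ _ _ _ (by omega) (by omega) (by omega) (by omega),
      key _ _ _ _ (by omega) (by omega) (by omega) (by omega), h]

/-- the first list element lies in the second, and one may cancel it -/
lemma four_mem {a b c d a' b' c' d' : ℕ}
    (h : 5 ^ a + 5 ^ b + 5 ^ c + 5 ^ d = 5 ^ a' + 5 ^ b' + 5 ^ c' + 5 ^ d') :
    a = a' ∨ a = b' ∨ a = c' ∨ a = d' := by
  have := four_pow h a
  by_contra hc
  push Not at hc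
  simp [hc.1.symm, hc.2.1.symm, hc.2.2.1.symm, hc.2.2.2.symm] at this
  
lemma three_mem {b c d b' c' d' : ℕ}
    (h : 5 ^ b + 5 ^ c + 5 ^ d = 5 ^ b' + 5 ^ c' + 5 ^ d') :
    b = b' ∨ b = c' ∨ b = d' := by
  have := four_pow (a := 0) (a' := 0) (b := b) (c := c) (d := d) (b' := b') (c' := c') (d' := d')
    (by omega) b
  by_contra hc
  push Not at hc
  simp [hc.1.symm, hc.2.1.symm, hc.2.2.symm] at this
  omega

lemma pow_inj5 {a b : ℕ} (h : 5 ^ a = 5 ^ b) : a = b := Nat.pow_right_injective (le_refl 2 |>.trans (by norm_num) : 2 ≤ 5) h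

lemma two_eq {c d c' d' : ℕ} (h : 5 ^ c + 5 ^ d = 5 ^ c' + 5 ^ d') :
    (c = c' ∧ d = d') ∨ (c = d' ∧ d = c') := by
  rcases three_mem (b := c) (c := d) (d := 0) (b' := c') (c' := d') (d' := 0) (by omega) with e | e | e
  · subst e; left; exact ⟨rfl, pow_inj5 (by omega)⟩
  · subst e; right; exact ⟨rfl, pow_inj5 (by omega)⟩
  · subst e
    rcases three_mem (b := c') (c := d') (d := 0) (b' := 0) (c' := d) (d' := 0) (by omega) with e | e | e
    · subst e; left; exact ⟨rfl, pow_inj5 (by omega)⟩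
    · subst e; right; exact ⟨pow_inj5 (by omega), rfl⟩
    · subst e; left; exact ⟨rfl, pow_inj5 (by omega)⟩

lemma cases8 {i j k l i' j' k' l' : ℕ} (h1 : j < i) (h2 : l < k) (h3 : j' < i') (h4 : l' < k')
    (h : 5 ^ i + 5 ^ k + 5 ^ j' + 5 ^ l' = 5 ^ i' + 5 ^ k' + 5 ^ j + 5 ^ l) :
    (i' = i ∧ j' = j ∧ k' = k ∧ l' = l) ∨
    (i' = k ∧ j' = l ∧ k' = i ∧ l' = j) ∨
    (i' = i ∧ j' = l ∧ k' = k ∧ l' = j) ∨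
    (i' = k ∧ j' = j ∧ k' = i ∧ l' = l) ∨
    (j = k ∧ j' = k' ∧ i = i' ∧ l = l') ∨
    (j = k ∧ l' = i' ∧ i = k' ∧ l = j') ∨
    (l = i ∧ j' = k' ∧ k = i' ∧ j = l') ∨
    (l = i ∧ l' = i' ∧ k = k' ∧ j = j') := by
  rcases four_mem h with e | e | e | e
  · subst e
    rcases three_mem (b := k) (c := j') (d := l') (b' := k') (c' := j) (d' := l) (by linarith) with e | e | e
    · subst e
      rcases two_eq (c := j') (d := l') (c' := j) (d' := l) (by linarith) with ⟨rfl, rfl⟩ | ⟨rfl, rfl⟩ <;>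
        clear h <;> first | (exfalso; omega) | simp
    · subst e
      rcases two_eq (c := j') (d := l') (c' := k') (d' := l) (by linarith) with ⟨rfl, rfl⟩ | ⟨rfl, rfl⟩ <;>
        clear h <;> first | (exfalso; omega) | simp
    · exfalso; clear h; omega
  · subst e
    rcases three_mem (b := k) (c := j') (d := l') (b' := i') (c' := j) (d' := l) (by linarith) with e | e | e
    · subst e
      rcases two_eq (c := j') (d := l') (c' := j) (d' := l) (by linarith) with ⟨rfl, rfl⟩ | ⟨rfl, rfl⟩ <;>
        clear h <;> first | (exfalso; omega) | simp
    · subst e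
      rcases two_eq (c := j') (d := l') (c' := i') (d' := l) (by linarith) with ⟨rfl, rfl⟩ | ⟨rfl, rfl⟩ <;>
        clear h <;> first | (exfalso; omega) | simp
    · exfalso; clear h; omega
  · exfalso; clear h; omega
  · subst e
    rcases three_mem (b := k) (c := j') (d := l') (b' := i') (c' := k') (d' := j) (by linarith) with e | e | e
    · subst e
      rcases two_eq (c := j') (d := l') (c' := k') (d' := j) (by linarith) with ⟨rfl, rfl⟩ | ⟨rfl, rfl⟩ <;>
        clear h <;> first | (exfalso; omega) | simp
    · subst e
      rcases two_eq (c := j') (d := l') (c' := i') (d' := j) (by linarith) with ⟨rfl, rfl⟩ | ⟨rfl, rfl⟩ <;>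
        clear h <;> first | (exfalso; omega) | simp
    · exfalso; clear h; omega

/-- Cauchy–Schwarz type bound. -/
lemma cs_bound {α β : Type*} [DecidableEq α] (T : Finset α) (g : α → ℝ)
    (X : Finset β) (u v w z : β → α)
    (hu : ∀ x ∈ X, u x ∈ T) (hv : ∀ x ∈ X, v x ∈ T) (hw : ∀ x ∈ X, w x ∈ T) (hz : ∀ x ∈ X, z x ∈ T)
    (h1 : ∀ x ∈ X, ∀ y ∈ X, u x = u y → v x = v y → x = y)
    (h2 : ∀ x ∈ X, ∀ y ∈ X, w x = w y → z x = z y → x = y) :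
    ∑ x ∈ X, g (u x) * g (v x) * (g (w x) * g (z x)) ≤ (∑ t ∈ T, g t ^ 2) ^ 2 := by
  have key : ∀ u v : β → α, (∀ x ∈ X, u x ∈ T) → (∀ x ∈ X, v x ∈ T) →
      (∀ x ∈ X, ∀ y ∈ X, u x = u y → v x = v y → x = y) →
      ∑ x ∈ X, (g (u x) * g (v x)) ^ 2 ≤ (∑ t ∈ T, g t ^ 2) ^ 2 := by
    intro u v hu hv h
    have : (∑ t ∈ T, g t ^ 2) ^ 2 = ∑ p ∈ T ×ˢ T, (g p.1 * g p.2) ^ 2 := by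
      rw [sq, Finset.sum_mul_sum, Finset.sum_product]
      simp only [mul_pow]
    rw [this, ← Finset.sum_image (s := X) (g := fun x => (u x, v x)) (f := fun p => (g p.1 * g p.2) ^ 2)]
    · apply Finset.sum_le_sum_of_subset_of_nonneg
      · intro p hp
        obtain ⟨x, hx, rfl⟩ := Finset.mem_image.1 hp
        exact Finset.mem_product.2 ⟨hu x hx, hv x hx⟩
      · intros; positivity
    · intro x hx y hy e
      simp only [Prod.mk.injEq] at e
      exact h x hx y hy e.1 e.2
  have a1 := key u v hu hv h1
  have a2 := key w z hw hz h2
  have : ∑ x ∈ X, g (u x) * g (v x) * (g (w x) * g (z x)) ≤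
      ∑ x ∈ X, ((g (u x) * g (v x)) ^ 2 + (g (w x) * g (z x)) ^ 2) / 2 := by
    refine Finset.sum_le_sum fun x _ => ?_
    nlinarith [sq_nonneg (g (u x) * g (v x) - g (w x) * g (z x))]
  rw [← Finset.sum_div, Finset.sum_add_distrib] at this
  linarith

def theS : Set ℤ := {ξ | ∃ i j : ℕ, j < i ∧ ξ = 5 ^ i - 5 ^ j}

lemma quad_bound (T : Finset ℤ) (hT : (T : Set ℤ) ⊆ theS) (g : ℤ → ℝ) (hg : ∀ t, 0 ≤ g t) :
    ∑ x ∈ ((T ×ˢ T) ×ˢ (T ×ˢ T)).filter (fun x => x.1.1 + x.1.2 = x.2.1 + x.2.2),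
      g x.1.1 * g x.1.2 * (g x.2.1 * g x.2.2) ≤ 8 * (∑ t ∈ T, g t ^ 2) ^ 2 := by
  classical
  have hd : ∀ t : ℤ, ∃ p : ℕ × ℕ, t ∈ T → p.2 < p.1 ∧ t = 5 ^ p.1 - 5 ^ p.2 := by
    intro t
    by_cases ht : t ∈ T
    · obtain ⟨i, j, h1, h2⟩ := hT ht
      exact ⟨(i, j), fun _ => ⟨h1, h2⟩⟩
    · exact ⟨(0, 0), fun h => absurd h ht⟩
  choose dec hdec using hd
  let hi : ℤ → ℕ := fun t => (dec t).1
  let lo : ℤ → ℕ := fun t => (dec t).2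
  have hlt : ∀ t ∈ T, lo t < hi t := fun t ht => (hdec t ht).1
  have heq : ∀ t ∈ T, t = 5 ^ hi t - 5 ^ lo t := fun t ht => (hdec t ht).2
  have hext : ∀ s ∈ T, ∀ t ∈ T, hi s = hi t → lo s = lo t → s = t := by
    intro s hs t ht e1 e2
    rw [heq s hs, heq t ht, e1, e2]
  clear_value hi lo
  set P := (T ×ˢ T) ×ˢ (T ×ˢ T) with hP
  have memP : ∀ x ∈ P, x.1.1 ∈ T ∧ x.1.2 ∈ T ∧ x.2.1 ∈ T ∧ x.2.2 ∈ T := by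
    intro x hx
    simp only [hP, Finset.mem_product] at hx
    tauto
  set B := (∑ t ∈ T, g t ^ 2) ^ 2
  let G : (ℤ × ℤ) × (ℤ × ℤ) → ℝ := fun x => g x.1.1 * g x.1.2 * (g x.2.1 * g x.2.2)
  have hG : ∀ x, 0 ≤ G x := fun x => by
    have := hg x.1.1; have := hg x.1.2; have := hg x.2.1; have := hg x.2.2
    positivity
  let C : Fin 8 → (ℤ × ℤ) × (ℤ × ℤ) → Prop := fun c x => 
    match c with
    | 0 => hi x.2.1 = hi x.1.1 ∧ lo x.2.1 = lo x.1.1 ∧ hi x.2.2 = hi x.1.2 ∧ lo x.2.2 = lo x.1.2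
    | 1 => hi x.2.1 = hi x.1.2 ∧ lo x.2.1 = lo x.1.2 ∧ hi x.2.2 = hi x.1.1 ∧ lo x.2.2 = lo x.1.1
    | 2 => hi x.2.1 = hi x.1.1 ∧ lo x.2.1 = lo x.1.2 ∧ hi x.2.2 = hi x.1.2 ∧ lo x.2.2 = lo x.1.1
    | 3 => hi x.2.1 = hi x.1.2 ∧ lo x.2.1 = lo x.1.1 ∧ hi x.2.2 = hi x.1.1 ∧ lo x.2.2 = lo x.1.2
    | 4 => lo x.1.1 = hi x.1.2 ∧ lo x.2.1 = hi x.2.2 ∧ hi x.1.1 = hi x.2.1 ∧ lo x.1.2 = lo x.2.2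
    | 5 => lo x.1.1 = hi x.1.2 ∧ lo x.2.2 = hi x.2.1 ∧ hi x.1.1 = hi x.2.2 ∧ lo x.1.2 = lo x.2.1
    | 6 => lo x.1.2 = hi x.1.1 ∧ lo x.2.1 = hi x.2.2 ∧ hi x.1.2 = hi x.2.1 ∧ lo x.1.1 = lo x.2.2
    | 7 => lo x.1.2 = hi x.1.1 ∧ lo x.2.2 = hi x.2.1 ∧ hi x.1.2 = hi x.2.2 ∧ lo x.1.1 = lo x.2.1
  have hC : ∀ x ∈ P, x.1.1 + x.1.2 = x.2.1 + x.2.2 → ∃ c, C c x := by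
    intro x hx h
    obtain ⟨m1, m2, m3, m4⟩ := memP x hx
    have e1 := heq _ m1
    have e2 := heq _ m2
    have e3 := heq _ m3
    have e4 := heq _ m4
    have hN : (5:ℤ) ^ hi x.1.1 + 5 ^ hi x.1.2 + 5 ^ lo x.2.1 + 5 ^ lo x.2.2
      = 5 ^ hi x.2.1 + 5 ^ hi x.2.2 + 5 ^ lo x.1.1 + 5 ^ lo x.1.2 := by linarith
    rcases cases8 (hlt _ m1) (hlt _ m2) (hlt _ m3) (hlt _ m4) (by exact_mod_cast hN)
      with h | h | h | h | h | h | h | h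
    exacts [⟨0, h⟩, ⟨1, h⟩, ⟨2, h⟩, ⟨3, h⟩, ⟨4, h⟩, ⟨5, h⟩, ⟨6, h⟩, ⟨7, h⟩]
  have hb : ∀ c, ∑ x ∈ P.filter (C c), G x ≤ B := by
    intro c
    have mm : ∀ x ∈ P.filter (C c), (x.1.1 ∈ T ∧ x.1.2 ∈ T ∧ x.2.1 ∈ T ∧ x.2.2 ∈ T) ∧ C c x :=
      fun x hx => ⟨memP x (Finset.mem_filter.1 hx).1, (Finset.mem_filter.1 hx).2⟩
    have fin : ∀ x ∈ P.filter (C c), ∀ y ∈ P.filter (C c),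
        (hi x.1.1 = hi y.1.1 ∧ lo x.1.1 = lo y.1.1 ∧ hi x.1.2 = hi y.1.2 ∧ lo x.1.2 = lo y.1.2 ∧
         hi x.2.1 = hi y.2.1 ∧ lo x.2.1 = lo y.2.1 ∧ hi x.2.2 = hi y.2.2 ∧ lo x.2.2 = lo y.2.2) →
        x = y := by
      intro x hx y hy ⟨h1, h2, h3, h4, h5, h6, h7, h8⟩
      obtain ⟨⟨a1, a2, a3, a4⟩, _⟩ := mm x hx
      obtain ⟨⟨b1, b2, b3, b4⟩, _⟩ := mm y hy
      exact Prod.ext (Prod.ext (hext _ a1 _ b1 h1 h2) (hext _ a2 _ b2 h3 h4))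
        (Prod.ext (hext _ a3 _ b3 h5 h6) (hext _ a4 _ b4 h7 h8))
    have b12 : (∀ x ∈ P.filter (C c), ∀ y ∈ P.filter (C c), x.1.1 = y.1.1 → x.1.2 = y.1.2 → x = y) →
        (∀ x ∈ P.filter (C c), ∀ y ∈ P.filter (C c), x.2.1 = y.2.1 → x.2.2 = y.2.2 → x = y) →
        ∑ x ∈ P.filter (C c), G x ≤ B := fun h1 h2 =>
      cs_bound T g _ (fun x => x.1.1) (fun x => x.1.2) (fun x => x.2.1) (fun x => x.2.2)
        (fun x hx => (mm x hx).1.1) (fun x hx => (mm x hx).1.2.1)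
        (fun x hx => (mm x hx).1.2.2.1) (fun x hx => (mm x hx).1.2.2.2) h1 h2
    have b14 : (∀ x ∈ P.filter (C c), ∀ y ∈ P.filter (C c), x.1.1 = y.1.1 → x.2.2 = y.2.2 → x = y) →
        (∀ x ∈ P.filter (C c), ∀ y ∈ P.filter (C c), x.1.2 = y.1.2 → x.2.1 = y.2.1 → x = y) →
        ∑ x ∈ P.filter (C c), G x ≤ B := fun h1 h2 => by
      refine le_trans (le_of_eq (Finset.sum_congr rfl fun x _ => ?_))
        (cs_bound T g _ (fun x => x.1.1) (fun x => x.2.2) (fun x => x.1.2) (fun x => x.2.1)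
        (fun x hx => (mm x hx).1.1) (fun x hx => (mm x hx).1.2.2.2)
        (fun x hx => (mm x hx).1.2.1) (fun x hx => (mm x hx).1.2.2.1) h1 h2)
      simp only [G]; ring
    have b13 : (∀ x ∈ P.filter (C c), ∀ y ∈ P.filter (C c), x.1.1 = y.1.1 → x.2.1 = y.2.1 → x = y) →
        (∀ x ∈ P.filter (C c), ∀ y ∈ P.filter (C c), x.1.2 = y.1.2 → x.2.2 = y.2.2 → x = y) →
        ∑ x ∈ P.filter (C c), G x ≤ B := fun h1 h2 => by
      refine le_trans (le_of_eq (Finset.sum_congr rfl fun x _ => ?_))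
        (cs_bound T g _ (fun x => x.1.1) (fun x => x.2.1) (fun x => x.1.2) (fun x => x.2.2)
        (fun x hx => (mm x hx).1.1) (fun x hx => (mm x hx).1.2.2.1)
        (fun x hx => (mm x hx).1.2.1) (fun x hx => (mm x hx).1.2.2.2) h1 h2)
      simp only [G]; ring
    fin_cases c
    on_goal 8 => apply b14
    on_goal 7 => apply b13
    on_goal 6 => apply b13
    on_goal 5 => apply b14
    on_goal 4 => apply b12
    on_goal 3 => apply b12
    on_goal 2 => apply b12
    on_goal 1 => apply b12
    all_goals
      intro x hx y hy e1 e2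
      have e1h := congrArg hi e1
      have e1l := congrArg lo e1
      have e2h := congrArg hi e2
      have e2l := congrArg lo e2
      have c1 := (mm x hx).2
      have c2 := (mm y hy).2
      refine fin x hx y hy ?_
      simp only [C] at c1 c2
      clear mm fin b12 b13 b14 hC
      omega
  calc _ ≤ ∑ x ∈ P, ∑ c : Fin 8, if C c x then G x else 0 := by
        rw [Finset.sum_filter]
        refine Finset.sum_le_sum fun x hx => ?_
        have nn : ∀ c ∈ (Finset.univ : Finset (Fin 8)), 0 ≤ if C c x then G x else 0 := by
          intro c _; split_ifs; exacts [hG x, le_rfl]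
        split_ifs with h
        · obtain ⟨c, hc⟩ := hC x hx h
          have := Finset.single_le_sum nn (Finset.mem_univ c)
          rw [if_pos hc] at this
          exact this
        · exact Finset.sum_nonneg nn
    _ = ∑ c : Fin 8, ∑ x ∈ P.filter (C c), G x := by
        rw [Finset.sum_comm]
        simp only [Finset.sum_filter]
    _ ≤ ∑ c : Fin 8, B := Finset.sum_le_sum fun c _ => hb c
    _ = 8 * B := by simp

open MeasureTheory in
lemma integral_fourier5 (n : ℤ) :
    ∫ x : AddCircle (1 : ℝ), fourier n x ∂AddCircle.haarAddCircle = if n = 0 then (1 : ℂ) else 0 := by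
  have := congrFun (fourierCoeff_fourier (T := (1 : ℝ)) n) 0
  simp only [fourierCoeff, neg_zero, fourier_zero, one_smul] at this
  rw [this, Pi.single_apply]
  simp [eq_comm]

open MeasureTheory ComplexConjugate in
lemma fourth_moment (T : Finset ℤ) (f : ℤ → ℂ) :
    ((∫ x : AddCircle (1 : ℝ), ‖∑ ξ ∈ T, f ξ * fourier ξ x‖ ^ 4 ∂AddCircle.haarAddCircle : ℝ) : ℂ)
    = ∑ x ∈ ((T ×ˢ T) ×ˢ (T ×ˢ T)).filter (fun x => x.1.1 + x.1.2 = x.2.1 + x.2.2),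
      f x.1.1 * f x.1.2 * (conj (f x.2.1) * conj (f x.2.2)) := by
  rw [← integral_complex_ofReal]
  have h : ∀ x : AddCircle (1 : ℝ), ((‖∑ ξ ∈ T, f ξ * fourier ξ x‖ ^ 4 : ℝ) : ℂ)
      = ∑ y ∈ (T ×ˢ T) ×ˢ (T ×ˢ T), f y.1.1 * f y.1.2 * (conj (f y.2.1) * conj (f y.2.2)) *
        fourier (y.1.1 + y.1.2 + (-y.2.1 + -y.2.2)) x := by
    intro x
    set F := ∑ ξ ∈ T, f ξ * fourier ξ x with hF
    have e : ((‖F‖ ^ 4 : ℝ) : ℂ) = (F * F) * (conj F * conj F) := by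
      have := Complex.mul_conj' F
      push_cast
      linear_combination (-(F * conj F) - (‖F‖ : ℂ) ^ 2) * this
    rw [e, hF, map_sum, Finset.sum_mul_sum, Finset.sum_mul_sum, ← Finset.sum_product',
      ← Finset.sum_product', Finset.sum_mul_sum, ← Finset.sum_product']
    refine Finset.sum_congr rfl fun y _ => ?_
    rw [fourier_add, fourier_add, fourier_add, fourier_neg, fourier_neg, map_mul, map_mul]
    ring
  simp_rw [h]
  rw [integral_finsetSum]
  · rw [Finset.sum_filter]
    refine Finset.sum_congr rfl fun y _ => ?_
    rw [integral_const_mul, integral_fourier5]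
    have : (y.1.1 + y.1.2 + (-y.2.1 + -y.2.2) = 0) ↔ (y.1.1 + y.1.2 = y.2.1 + y.2.2) := by
      constructor <;> intro h <;> linarith
    simp only [this]
    split_ifs <;> simp
  · intro y _
    apply Continuous.integrable_of_hasCompactSupport
    · fun_prop
    · exact HasCompactSupport.of_compactSpace _

open MeasureTheory in
lemma lambda4 : SatisfiesLambda4 theS 2 := by
  intro f hf
  have hcont : Continuous (fun x : AddCircle (1 : ℝ) => ∑ ξ ∈ f.support, f ξ * fourier ξ x) := by
    fun_prop
  have hm : MemLp (fun x : AddCircle (1 : ℝ) => ∑ ξ ∈ f.support, f ξ * fourier ξ x) 4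
      AddCircle.haarAddCircle := by
    exact hcont.memLp_of_hasCompactSupport (HasCompactSupport.of_compactSpace _)
  rw [hm.eLpNorm_eq_integral_rpow_norm (by norm_num) (by norm_num)]
  apply ENNReal.ofReal_le_ofReal
  have h4 : (4 : ENNReal).toReal = (4 : ℕ) := by norm_num
  simp only [h4, Real.rpow_natCast]
  set I := ∫ x : AddCircle (1 : ℝ), ‖∑ ξ ∈ f.support, f ξ * fourier ξ x‖ ^ 4 ∂AddCircle.haarAddCircle
    with hI
  have hI0 : 0 ≤ I := integral_nonneg fun x => by positivity
  have hb : I ≤ 8 * (∑ t ∈ f.support, ‖f t‖ ^ 2) ^ 2 := by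
    refine le_trans ?_ (quad_bound f.support hf (fun t => ‖f t‖) (fun t => norm_nonneg _))
    have : I = ‖(I : ℂ)‖ := by
      rw [Complex.norm_real, Real.norm_of_nonneg hI0]
    rw [this, hI, fourth_moment]
    refine (norm_sum_le _ _).trans (le_of_eq (Finset.sum_congr rfl fun x _ => ?_))
    simp
  set A := ∑ t ∈ f.support, ‖f t‖ ^ 2
  have hA : 0 ≤ A := Finset.sum_nonneg fun _ _ => by positivity
  have hR : I ≤ (2 * Real.sqrt A) ^ 4 := by
    have : (2 * Real.sqrt A) ^ 4 = 16 * (Real.sqrt A ^ 2) ^ 2 := by ring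
    rw [this, Real.sq_sqrt hA]
    nlinarith [sq_nonneg A]
  calc I ^ ((4 : ℕ) : ℝ)⁻¹ ≤ ((2 * Real.sqrt A) ^ 4) ^ ((4 : ℕ) : ℝ)⁻¹ :=
        Real.rpow_le_rpow hI0 hR (by positivity)
    _ = 2 * Real.sqrt A := Real.pow_rpow_inv_natCast (by positivity) (by norm_num)

open Filter in
lemma not_union (k g : ℕ) (T : Fin k → Set ℤ) (hT : ∀ i, IsB2 g (T i) ∨ IsB2Circ g (T i))
    (hS : theS = ⋃ i, T i) : False := by
  have hcol : ∀ i j : ℕ, i < j → ∃ c, (5 ^ j - 5 ^ i : ℤ) ∈ T c := by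
    intro i j h
    have : (5 ^ j - 5 ^ i : ℤ) ∈ theS := ⟨j, i, h, rfl⟩
    rw [hS] at this
    exact Set.mem_iUnion.1 this
  let U : Ultrafilter ℕ := hyperfilter ℕ
  have hgt : ∀ i : ℕ, ∀ᶠ j in (U : Filter ℕ), i < j := by
    intro i
    have : (U : Filter ℕ) ≤ atTop := by
      rw [← Nat.cofinite_eq_atTop]; exact hyperfilter_le_cofinite
    exact this (eventually_gt_atTop i)
  have hinf : ∀ P : ℕ → Prop, (∀ᶠ j in (U : Filter ℕ), P j) → {j | P j}.Infinite := by
    intro P h hfin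
    exact notMem_hyperfilter_of_finite hfin h
  have h1 : ∀ i, ∃ c, ∀ᶠ j in (U : Filter ℕ), (5 ^ j - 5 ^ i : ℤ) ∈ T c := by
    intro i
    rw [← Ultrafilter.eventually_exists_iff]
    exact (hgt i).mono fun j hj => hcol i j hj
  obtain ⟨c, hc⟩ : ∃ c, ∀ᶠ i in (U : Filter ℕ), ∀ᶠ j in (U : Filter ℕ), (5 ^ j - 5 ^ i : ℤ) ∈ T c := by
    rw [← Ultrafilter.eventually_exists_iff]
    exact Eventually.of_forall h1
  have pinj : ∀ {a b : ℕ}, (5 : ℤ) ^ a = 5 ^ b → a = b := fun h => pow_inj5 (by exact_mod_cast h)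
  obtain ⟨v, hv⟩ := hc.exists
  rcases hT c with h | h
  · have hM := hinf _ (hc.and (hv.and (hgt v)))
    obtain ⟨M, hMs, hMc⟩ := hM.exists_subset_card_eq (g + 1)
    have : ∀ᶠ t in (U : Filter ℕ), ∀ m ∈ M, (5 ^ t - 5 ^ m : ℤ) ∈ T c ∧ m < t := by
      rw [Finset.eventually_all]
      intro m hm
      exact (hMs hm).1.and (hgt m)
    obtain ⟨t, ht⟩ := this.exists
    have hle := h (5 ^ t - 5 ^ v)
    have hsub : Set.image (fun m : ℕ => s((5 ^ t - 5 ^ m : ℤ), 5 ^ m - 5 ^ v)) (M : Set ℕ) ⊆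
        {p : Sym2 ℤ | ∃ a ∈ T c, ∃ b ∈ T c, p = s(a, b) ∧ a + b = 5 ^ t - 5 ^ v} := by
      rintro _ ⟨m, hm, rfl⟩
      exact ⟨_, (ht m hm).1, _, (hMs hm).2.1, rfl, by ring⟩
    have hinj : Set.InjOn (fun m : ℕ => s((5 ^ t - 5 ^ m : ℤ), 5 ^ m - 5 ^ v)) (M : Set ℕ) := by
      intro m hm m' hm' e
      simp only [Sym2.eq_iff] at e
      rcases e with e | e
      · exact pinj (by linarith [e.1])
      · have e' : (5 : ℤ) ^ t + 5 ^ v = 5 ^ m + 5 ^ m' := by linarith [e.1]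
        have l1 := (ht m hm).2
        have l2 := (ht m' hm').2
        rcases two_eq (by exact_mod_cast e' : 5 ^ t + 5 ^ v = 5 ^ m + 5 ^ m') with e | e <;> omega
    have := (Set.encard_le_encard hsub).trans hle
    rw [hinj.encard_image, Set.encard_coe_eq_coe_finsetCard, hMc] at this
    have : g + 1 ≤ g := by exact_mod_cast this
    omega
  · obtain ⟨w, hw, hvw⟩ := (hc.and (hgt v)).exists
    have hM := hinf _ (hv.and hw)
    have hle := h (5 ^ w - 5 ^ v) (by
      intro e
      have := pinj (sub_eq_zero.1 e)
      omega)
    have hsub : Set.image (fun j : ℕ => ((5 ^ j - 5 ^ v : ℤ), (5 ^ j - 5 ^ w : ℤ)))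
        {j | (5 ^ j - 5 ^ v : ℤ) ∈ T c ∧ (5 ^ j - 5 ^ w : ℤ) ∈ T c} ⊆
        {p : ℤ × ℤ | p.1 ∈ T c ∧ p.2 ∈ T c ∧ p.1 - p.2 = 5 ^ w - 5 ^ v} := by
      rintro _ ⟨m, hm, rfl⟩
      exact ⟨hm.1, hm.2, by simp⟩
    have hinj : Function.Injective (fun j : ℕ => ((5 ^ j - 5 ^ v : ℤ), (5 ^ j - 5 ^ w : ℤ))) := by
      intro m m' e
      simp only [Prod.mk.injEq] at e
      exact pinj (by linarith [e.1])
    have := (Set.encard_le_encard hsub).trans hle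
    rw [hinj.encard_image, hM.encard_eq] at this
    simp at this

theorem stmt_19 :
    ∃ S : Set ℤ, ∃ K : ℝ, 0 < K ∧ SatisfiesLambda4 S K ∧
      ∀ k g : ℕ, 0 < k → 0 < g →
        ¬ ∃ T : Fin k → Set ℤ,
            (∀ i, IsB2 g (T i) ∨ IsB2Circ g (T i)) ∧ S = ⋃ i, T i := by
  refine ⟨theS, 2, by norm_num, lambda4, ?_⟩
  rintro k g - - ⟨T, h1, h2⟩
  exact not_union k g T h1 h2
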